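/- arXiv:2201.11413 — 5 statements merged into one kernel-verified Lean document; each statement's English description precedes it below -/
import Mathlib

section
/- Let E be a real inner product space, let γ ≥ 1, and let T : E → E satisfy ‖T x - T y‖ ≤ (1/γ)·‖x - y‖ for all x, y ∈ E. Suppose x, y, u, v ∈ E satisfy T(x + u) = x - (1/γ)·u and T(y + v) = y - (1/γ)·v. Then ⟨u - v, x - y⟩ ≥ ((γ - 1)/2)·‖x - y‖². (This expresses that the operator A = (T + γ⁻¹·I)⁻¹ ∘ (1 + γ⁻¹)·I − I, whose graph consists exactly of the pairs (x, u) with T(x+u) = x − u/γ, is (γ−1)/2-strongly monotone.) -/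
open scoped RealInnerProductSpace

/-- If `T` is `(1/γ)`-Lipschitz with `γ ≥ 1`, then the operator
`A = (T + γ⁻¹ I)⁻¹ (1 + γ⁻¹) - I`, whose graph consists of pairs `(x, u)` with
`T (x + u) = x - γ⁻¹ u`, is `(γ-1)/2`-strongly monotone. -/
theorem strongly_monotone_of_contraction
    {E : Type*} [NormedAddCommGroup E] [InnerProductSpace ℝ E]
    (γ : ℝ) (hγ : 1 ≤ γ) (T : E → E)
    (hT : ∀ x y : E, ‖T x - T y‖ ≤ (1 / γ) * ‖x - y‖)
    (x y u v : E)
    (hxu : T (x + u) = x - (1 / γ) • u)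
    (hyv : T (y + v) = y - (1 / γ) • v) :
    ⟪u - v, x - y⟫ ≥ ((γ - 1) / 2) * ‖x - y‖ ^ 2 := by
  have hγ0 : 0 < γ := by linarith
  have h := hT (x + u) (y + v)
  rw [hxu, hyv, show x - (1 / γ) • u - (y - (1 / γ) • v) = (1 / γ) • (γ • (x - y) - (u - v)) by
      rw [smul_sub, smul_smul, one_div_mul_cancel hγ0.ne', one_smul]; module,
    show x + u - (y + v) = (x - y) + (u - v) by abel, norm_smul,
    Real.norm_of_nonneg (by positivity)] at h
  have h_sq := pow_le_pow_left₀ (norm_nonneg _) (le_of_mul_le_mul_left h (by positivity)) 2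
  rw [norm_sub_sq_real, norm_add_sq_real, norm_smul, inner_smul_left,
    real_inner_comm (u - v), Real.norm_of_nonneg hγ0.le] at h_sq
  simp only [conj_trivial] at h_sq
  refine le_of_mul_le_mul_left ?_ (show 0 < 2 * (γ + 1) by linarith)
  linarith
end

section
/- Let E be a real inner product space, let μ ≥ 0, and let A : E → Set E be μ-strongly monotone. Suppose x, u, y, v ∈ E satisfy ((1+2μ)/(2+2μ))·(x - u) ∈ A( (1/(2+2μ))·x + ((1+2μ)/(2+2μ))·u ) and ((1+2μ)/(2+2μ))·(y - v) ∈ A( (1/(2+2μ))·y + ((1+2μ)/(2+2μ))·v ). Then ‖u - v‖ ≤ (1/(1+2μ))·‖x - y‖. (This expresses that T = (1 + 1/(1+2μ))·J_A − (1/(1+2μ))·I, where J_A = (I + A)⁻¹ is the resolvent of A, is (1/(1+2μ))-Lipschitz.) -/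
open scoped RealInnerProductSpace

/-- If `A` is `μ`-strongly monotone with `μ ≥ 0`, then
`T = (1 + 1/(1+2μ)) J_A - (1/(1+2μ)) I` is `1/(1+2μ)`-Lipschitz, where the relation
`u = T x` is expressed by `((1+2μ)/(2+2μ))(x - u) ∈ A((1/(2+2μ))x + ((1+2μ)/(2+2μ))u)`. -/
theorem lipschitz_of_strongly_monotone
    {E : Type*} [NormedAddCommGroup E] [InnerProductSpace ℝ E]
    (μ : ℝ) (hμ : 0 ≤ μ) (A : E → Set E)
    (hA : ∀ x y u v : E, u ∈ A x → v ∈ A y → ⟪u - v, x - y⟫ ≥ μ * ‖x - y‖ ^ 2)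
    (x u y v : E)
    (hx : ((1 + 2 * μ) / (2 + 2 * μ)) • (x - u) ∈
      A ((1 / (2 + 2 * μ)) • x + ((1 + 2 * μ) / (2 + 2 * μ)) • u))
    (hy : ((1 + 2 * μ) / (2 + 2 * μ)) • (y - v) ∈
      A ((1 / (2 + 2 * μ)) • y + ((1 + 2 * μ) / (2 + 2 * μ)) • v)) :
    ‖u - v‖ ≤ (1 / (1 + 2 * μ)) * ‖x - y‖ := by
  have hk : 0 < 1 + 2 * μ := by linarith
  have hs : 0 < 2 + 2 * μ := by linarith
  have hmono := hA _ _ _ _ hx hy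
  set d := x - y with hd
  set e := u - v with he
  set k := 1 + 2 * μ with hkdef
  set s := 1 / (2 + 2 * μ) with hsdef
  have hs_pos : 0 < s := by positivity
  have hks : k / (2 + 2 * μ) = k * s := by rw [hsdef]; ring
  rw [hks] at hmono
  have h_image : (k * s) • (x - u) - (k * s) • (y - v) = (k * s) • (d - e) := by
    rw [hd, he]; module
  have h_point : s • x + (k * s) • u - (s • y + (k * s) • v) = s • (d + k • e) := by
    rw [hd, he]; module
  have h_inner : ⟪(k * s) • (d - e), s • (d + k • e)⟫ =
      s ^ 2 * (k * (‖d‖ ^ 2 + (k - 1) * ⟪d, e⟫ - k * ‖e‖ ^ 2)) := by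
    simp only [inner_smul_left, inner_smul_right, inner_sub_left, inner_add_right,
      real_inner_self_eq_norm_sq, real_inner_comm d e, conj_trivial]
    ring
  have h_norm : ‖s • (d + k • e)‖ ^ 2 =
      s ^ 2 * (‖d‖ ^ 2 + 2 * k * ⟪d, e⟫ + k ^ 2 * ‖e‖ ^ 2) := by
    rw [norm_smul, mul_pow, norm_add_sq_real, inner_smul_right, norm_smul, mul_pow]
    simp only [Real.norm_eq_abs, sq_abs]
    ring
  rw [h_image, h_point, h_inner, h_norm] at hmono
  have h_scaled : 0 ≤ (s ^ 2 * (1 + μ)) * (‖d‖ ^ 2 - (k * ‖e‖) ^ 2) := by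
    rw [hkdef] at hmono ⊢
    linarith
  have h_sq : (k * ‖e‖) ^ 2 ≤ ‖d‖ ^ 2 :=
    sub_nonneg.mp (nonneg_of_mul_nonneg_right h_scaled (by positivity))
  have h_le : k * ‖e‖ ≤ ‖d‖ := (sq_le_sq₀ (by positivity) (norm_nonneg d)).mp h_sq
  rw [one_div_mul_eq_div, le_div_iff₀ hk]
  linarith
end

section
/- Let E be a real inner product space, let γ ≥ 1, let T : E → E, and define G : E → E by G = (γ/(1+γ))·(I - T), i.e. G x = (γ/(1+γ))·(x - T x). Then T is (1/γ)-Lipschitz (‖T x - T y‖ ≤ (1/γ)‖x - y‖ for all x, y) if and only if G is (1/(1+γ))-averaged in the sense that for all x, y ∈ E, ‖G x - G y‖² + ((γ - 1)/(γ + 1))·‖x - y‖² ≤ (2γ/(γ + 1))·⟨G x - G y, x - y⟩. -/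
open scoped RealInnerProductSpace

/-- The averagedness defect of `(γ/(1+γ))(u - v)` relative to `u` is a positive multiple of
`γ²‖v‖² - ‖u‖²`. -/
lemma averaged_defect_eq {E : Type*} [NormedAddCommGroup E] [InnerProductSpace ℝ E]
    {γ : ℝ} (hγ : 1 + γ ≠ 0) (u v : E) :
    ‖(γ / (1 + γ)) • (u - v)‖ ^ 2 + ((γ - 1) / (γ + 1)) * ‖u‖ ^ 2 -
      (2 * γ / (γ + 1)) * ⟪(γ / (1 + γ)) • (u - v), u⟫ =
    ((γ * ‖v‖) ^ 2 - ‖u‖ ^ 2) / (1 + γ) ^ 2 := by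
  rw [norm_smul, mul_pow, Real.norm_eq_abs, sq_abs, norm_sub_sq_real, real_inner_smul_left,
    inner_sub_left, real_inner_self_eq_norm_sq, real_inner_comm, add_comm γ 1]
  field_simp
  ring

/-- `T` is `(1/γ)`-Lipschitz if and only if `G = (γ/(1+γ))(I - T)` is
`1/(1+γ)`-averaged, expressed by the inequality
`‖Gx - Gy‖² + ((γ-1)/(γ+1))‖x-y‖² ≤ (2γ/(γ+1))⟪Gx - Gy, x - y⟫`. -/
theorem contraction_iff_averaged
    {E : Type*} [NormedAddCommGroup E] [InnerProductSpace ℝ E]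
    (γ : ℝ) (hγ : 1 ≤ γ) (T G : E → E)
    (hG : ∀ x : E, G x = (γ / (1 + γ)) • (x - T x)) :
    (∀ x y : E, ‖T x - T y‖ ≤ (1 / γ) * ‖x - y‖) ↔
    (∀ x y : E, ‖G x - G y‖ ^ 2 + ((γ - 1) / (γ + 1)) * ‖x - y‖ ^ 2 ≤
      (2 * γ / (γ + 1)) * ⟪G x - G y, x - y⟫) := by
  have hpos : 0 < γ := by linarith
  refine forall_congr' fun x => forall_congr' fun y => ?_
  have hd : G x - G y = (γ / (1 + γ)) • ((x - y) - (T x - T y)) := by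
    rw [hG, hG, ← smul_sub, sub_sub_sub_comm]
  rw [hd, ← sub_nonpos (b := _ * ⟪_, _⟫), averaged_defect_eq (by positivity),
    div_le_iff₀ (by positivity), zero_mul, sub_nonpos, sq_le_sq₀ (by positivity) (by positivity),
    one_div_mul_eq_div, le_div_iff₀' hpos]
end

section
/- Let E be a real inner product space, let μ > 0 and α > 1, and let A : E → Set E be monotone and uniformly monotone with parameters μ and α: ⟨u, x - x⋆⟩ ≥ μ‖x - x⋆‖^{α+1} for every x ∈ E, u ∈ A x, where x⋆ is a point with 0 ∈ A x⋆. Let (x_k)_{k≥0} be proximal point iterates: x_k - x_{k+1} ∈ A x_{k+1} for every k ≥ 0 (i.e. x_{k+1} = J_A x_k). Set A_k = ‖x_k - x⋆‖² and B_k = ‖x_k - x_{k+1}‖². Then for every k ≥ 0: (i) A_k ≥ A_{k+1}·(1 + μ·A_{k+1}^{(α-1)/2})², and (ii) B_k ≥ B_{k+1}. -/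
open scoped RealInnerProductSpace

/-- If `0 ≤ ⟪u - v, v⟫`, then `‖v‖ ≤ ‖u‖`. -/
theorem norm_le_norm_of_inner_sub_nonneg {E : Type*} [NormedAddCommGroup E]
    [InnerProductSpace ℝ E] {u v : E} (h : 0 ≤ ⟪u - v, v⟫) : ‖v‖ ≤ ‖u‖ := by
  rw [inner_sub_left, real_inner_self_eq_norm_sq] at h
  have hcs := real_inner_le_norm u v
  by_contra! hlt
  nlinarith [norm_nonneg u]

/-- A lower bound on `‖u + a‖` from a power-type lower bound on `⟪u, a⟫`. -/
theorem norm_mul_one_add_rpow_le_norm_add {E : Type*} [NormedAddCommGroup E]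
    [InnerProductSpace ℝ E] {μ α : ℝ} {u a : E} (h : μ * ‖a‖ ^ (α + 1) ≤ ⟪u, a⟫) :
    ‖a‖ * (1 + μ * ‖a‖ ^ (α - 1)) ≤ ‖u + a‖ := by
  rcases (norm_nonneg a).eq_or_lt with ha | ha
  · simp [← ha]
  · have hcs := real_inner_le_norm (u + a) a
    rw [inner_add_left, real_inner_self_eq_norm_sq] at hcs
    have hpow : ‖a‖ ^ (α + 1) = ‖a‖ ^ (α - 1) * ‖a‖ ^ 2 := by
      rw [← Real.rpow_natCast, ← Real.rpow_add ha]
      congr 1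
      push_cast
      ring
    rw [hpow] at h
    refine le_of_mul_le_mul_right ?_ ha
    linarith

/-- For a uniformly monotone operator `A` (parameters `μ > 0`, `α > 1`)
with zero `x⋆` and proximal point iterates `x_{k+1} = J_A x_k`, writing
`A_k = ‖x_k - x⋆‖²` and `B_k = ‖x_k - x_{k+1}‖²`, we have
`A_k ≥ A_{k+1}(1 + μ A_{k+1}^{(α-1)/2})²` and `B_k ≥ B_{k+1}`. -/
theorem ppm_one_step
    {E : Type*} [NormedAddCommGroup E] [InnerProductSpace ℝ E]
    (μ α : ℝ) (hμ : 0 < μ) (hα : 1 < α)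
    (A : E → Set E)
    (hmono : ∀ x y u v : E, u ∈ A x → v ∈ A y → 0 ≤ ⟪u - v, x - y⟫)
    (xstar : E) (hzero : (0 : E) ∈ A xstar)
    (hunif : ∀ (x u : E), u ∈ A x → ⟪u, x - xstar⟫ ≥ μ * ‖x - xstar‖ ^ (α + 1))
    (x : ℕ → E) (hppm : ∀ k : ℕ, x k - x (k + 1) ∈ A (x (k + 1))) :
    ∀ k : ℕ,
      ‖x k - xstar‖ ^ 2 ≥
        ‖x (k + 1) - xstar‖ ^ 2 *
          (1 + μ * (‖x (k + 1) - xstar‖ ^ 2) ^ ((α - 1) / 2)) ^ 2 ∧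
      ‖x k - x (k + 1)‖ ^ 2 ≥ ‖x (k + 1) - x (k + 2)‖ ^ 2 := by
  intro k
  have hx := hunif _ _ (hppm k)
  have hm := hmono _ _ _ _ (hppm k) (hppm (k + 1))
  constructor
  · have hsum : x k - xstar = (x k - x (k + 1)) + (x (k + 1) - xstar) := by abel
    have hnn : 0 ≤ ‖x (k + 1) - xstar‖ * (1 + μ * ‖x (k + 1) - xstar‖ ^ (α - 1)) := by
      positivity
    have h := pow_le_pow_left₀ hnn (norm_mul_one_add_rpow_le_norm_add hx) 2
    rw [← hsum, mul_pow] at h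
    have hpow : (‖x (k + 1) - xstar‖ ^ 2) ^ ((α - 1) / 2) =
        ‖x (k + 1) - xstar‖ ^ (α - 1) := by
      rw [← Real.rpow_natCast, ← Real.rpow_mul (norm_nonneg _)]
      congr 1
      push_cast
      ring
    rw [hpow]
    exact h
  · exact pow_le_pow_left₀ (norm_nonneg _) (norm_le_norm_of_inner_sub_nonneg hm) 2
end

section
/- Let E be a real inner product space, let μ > 0 and α > 1, and let A : E → Set E be monotone and uniformly monotone with parameters μ and α, with 0 ∈ A x⋆. Let (x_k)_{k≥0} be proximal point iterates: x_k - x_{k+1} ∈ A x_{k+1} for every k ≥ 0. Set C = max{ ( (2^{α/(α-1)} - 2)/μ )^{2/(α-1)}, ‖x_0 - x⋆‖² }. Then for every k ≥ 1, ‖x_k - x⋆‖² ≤ C / k^{2/(α-1)}. -/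
open scoped RealInnerProductSpace

/-- The chord bound for the convex function `t ↦ (1 + t) ^ (p + 1)` on `[0, 1]`, with `t = k⁻¹`. -/
lemma add_one_rpow_le {p k : ℝ} (hp : 0 ≤ p) (hk : 1 ≤ k) :
    (k + 1) ^ (p + 1) ≤ k ^ p * (k + ((2 : ℝ) ^ (p + 1) - 1)) := by
  have hk0 : 0 < k := by linarith
  have hle : k⁻¹ ≤ 1 := inv_le_one_of_one_le₀ hk
  have hconv := (convexOn_rpow (show 1 ≤ p + 1 by linarith)).2
    (show (1 : ℝ) ∈ Set.Ici 0 by simp) (show (2 : ℝ) ∈ Set.Ici 0 by simp)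
    (sub_nonneg.2 hle) (inv_nonneg.2 hk0.le) (by ring)
  simp only [smul_eq_mul, Real.one_rpow, mul_one] at hconv
  have hsplit : k + 1 = k * (1 - k⁻¹ + k⁻¹ * 2) := by field_simp; ring
  have hpow : k ^ (p + 1) = k ^ p * k := by rw [Real.rpow_add hk0, Real.rpow_one]
  calc (k + 1) ^ (p + 1) = k ^ (p + 1) * (1 - k⁻¹ + k⁻¹ * 2) ^ (p + 1) := by
        rw [hsplit, Real.mul_rpow hk0.le (by nlinarith [inv_pos.2 hk0])]
    _ ≤ k ^ (p + 1) * (1 - k⁻¹ + k⁻¹ * (2 : ℝ) ^ (p + 1)) := by gcongr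
    _ = k ^ p * (k + ((2 : ℝ) ^ (p + 1) - 1)) := by rw [hpow]; field_simp; ring

/-- If `⟪y - z, z⟫ ≥ μ ‖z‖ ^ (α + 1)`, then `‖z‖ + μ ‖z‖ ^ α ≤ ‖y‖`. -/
lemma norm_add_rpow_le_of_inner {E : Type*} [NormedAddCommGroup E] [InnerProductSpace ℝ E]
    {μ α : ℝ} (hα : 0 < α) {y z : E} (h : μ * ‖z‖ ^ (α + 1) ≤ ⟪y - z, z⟫) :
    ‖z‖ + μ * ‖z‖ ^ α ≤ ‖y‖ := by
  rcases (norm_nonneg z).eq_or_lt with hz | hz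
  · simp [← hz, Real.zero_rpow hα.ne']
  · rw [inner_sub_left, real_inner_self_eq_norm_sq, Real.rpow_add hz, Real.rpow_one] at h
    have hcs := real_inner_le_norm y z
    exact le_of_mul_le_mul_right (by nlinarith) hz

/-- A sequence with `d (k + 1) + μ d (k + 1) ^ α ≤ d k` decays like `k ^ (-p)`, `p = 1 / (α - 1)`. -/
lemma le_div_rpow_of_add_rpow_le {μ α p D : ℝ} (hμ : 0 < μ) (hα : 1 < α) (hp : p * (α - 1) = 1)
    (hD : 0 < D) (hDμ : (2 : ℝ) ^ (p + 1) - 2 ≤ μ * D ^ (α - 1)) {d : ℕ → ℝ}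
    (hd : ∀ k, 0 ≤ d k) (hd0 : d 0 ≤ D) (hrec : ∀ k, d (k + 1) + μ * d (k + 1) ^ α ≤ d k)
    {k : ℕ} (hk : 1 ≤ k) : d k ≤ D / (k : ℝ) ^ p := by
  have hp0 : 0 < p := pos_of_mul_pos_left (hp ▸ one_pos) (by linarith)
  induction k, hk using Nat.le_induction with
  | base =>
    have := mul_nonneg hμ.le (Real.rpow_nonneg (hd 1) α)
    simpa using by linarith [hrec 0]
  | succ k hk ih =>
    by_contra! hlt
    have hk1 : (1 : ℝ) ≤ k := by exact_mod_cast hk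
    have hk0 : (0 : ℝ) < k := by linarith
    have hk' : (0 : ℝ) < k + 1 := by linarith
    push_cast at hlt
    have hkp := Real.rpow_pos_of_pos hk0 p
    have hkp' := Real.rpow_pos_of_pos hk' p
    have hpow : (D / ((k : ℝ) + 1) ^ p) ^ α < d (k + 1) ^ α :=
      Real.rpow_lt_rpow (by positivity) hlt (by linarith)
    have hDα : D ^ α = D * D ^ (α - 1) := by
      rw [← Real.rpow_one_add' hD.le (by linarith)]; congr 1; ring
    have hq : ((k : ℝ) + 1) ^ (p + 1) = ((k : ℝ) + 1) ^ p * (k + 1) := by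
      rw [Real.rpow_add hk', Real.rpow_one]
    rw [Real.div_rpow hD.le hkp'.le, ← Real.rpow_mul hk'.le,
      show p * α = p + 1 by linarith, hq, hDα] at hpow
    have hchord := add_one_rpow_le hp0.le hk1
    rw [hq] at hchord
    have hmain : D / (k : ℝ) ^ p ≤ D / ((k : ℝ) + 1) ^ p +
        μ * (D * D ^ (α - 1) / (((k : ℝ) + 1) ^ p * (k + 1))) := by
      have hsum : D / ((k : ℝ) + 1) ^ p + μ * (D * D ^ (α - 1) / (((k : ℝ) + 1) ^ p * (k + 1))) =
          D * (k + 1 + μ * D ^ (α - 1)) / (((k : ℝ) + 1) ^ p * (k + 1)) := by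
        field_simp
      rw [hsum, div_le_div_iff₀ hkp (by positivity), mul_assoc]
      refine mul_le_mul_of_nonneg_left (hchord.trans ?_) hD.le
      rw [mul_comm]
      exact mul_le_mul_of_nonneg_right (by linarith) hkp.le
    linarith [hrec k, mul_lt_mul_of_pos_left hpow hμ]

/-- For a uniformly monotone operator `A` (parameters `μ > 0`, `α > 1`)
with zero `x⋆` and proximal point iterates `x_{k+1} = J_A x_k`, the distance to the
solution satisfies `‖x_k - x⋆‖² ≤ C / k^{2/(α-1)}` for every `k ≥ 1`, where
`C = max{ ((2^{α/(α-1)} - 2)/μ)^{2/(α-1)}, ‖x₀ - x⋆‖² }`. -/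
theorem ppm_distance_rate
    {E : Type*} [NormedAddCommGroup E] [InnerProductSpace ℝ E]
    (μ α : ℝ) (hμ : 0 < μ) (hα : 1 < α)
    (A : E → Set E)
    (hmono : ∀ x y u v : E, u ∈ A x → v ∈ A y → 0 ≤ ⟪u - v, x - y⟫)
    (xstar : E) (hzero : (0 : E) ∈ A xstar)
    (hunif : ∀ (x u : E), u ∈ A x → ⟪u, x - xstar⟫ ≥ μ * ‖x - xstar‖ ^ (α + 1))
    (x : ℕ → E) (hppm : ∀ k : ℕ, x k - x (k + 1) ∈ A (x (k + 1))) :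
    ∀ k : ℕ, 1 ≤ k →
      ‖x k - xstar‖ ^ 2 ≤
        max ((((2 : ℝ) ^ (α / (α - 1)) - 2) / μ) ^ (2 / (α - 1))) (‖x 0 - xstar‖ ^ 2) /
          (k : ℝ) ^ (2 / (α - 1)) := by
  intro k hk
  have hα1 : 0 < α - 1 := by linarith
  set p : ℝ := 1 / (α - 1) with hp_def
  have hp : p * (α - 1) = 1 := by rw [hp_def]; field_simp
  have hp0 : 0 < p := by positivity
  have hq : α / (α - 1) = p + 1 := by rw [hp_def]; field_simp; ring
  have h2p : 2 / (α - 1) = p * (2 : ℕ) := by rw [hp_def]; push_cast; ring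
  rw [hq, h2p, Real.rpow_mul_natCast (Nat.cast_nonneg k)]
  set a : ℝ := ((2 : ℝ) ^ (p + 1) - 2) / μ with ha_def
  have ha : 0 < a := by
    have := Real.rpow_lt_rpow_of_exponent_lt one_lt_two (show 1 < p + 1 by linarith)
    rw [Real.rpow_one] at this
    exact div_pos (by linarith) hμ
  rw [Real.rpow_mul_natCast ha.le]
  have hap : 0 < a ^ p := Real.rpow_pos_of_pos ha p
  set D := max (a ^ p) ‖x 0 - xstar‖ with hD_def
  have hD : 0 < D := lt_max_of_lt_left hap
  have hDμ : (2 : ℝ) ^ (p + 1) - 2 ≤ μ * D ^ (α - 1) := by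
    have := Real.rpow_le_rpow hap.le (le_max_left (a ^ p) ‖x 0 - xstar‖) hα1.le
    rw [← Real.rpow_mul ha.le, hp, Real.rpow_one, ha_def, div_le_iff₀ hμ] at this
    linarith
  have hrec (j : ℕ) : ‖x (j + 1) - xstar‖ + μ * ‖x (j + 1) - xstar‖ ^ α ≤ ‖x j - xstar‖ :=
    norm_add_rpow_le_of_inner (by linarith) (by simpa using hunif _ _ (hppm j))
  have hdist := le_div_rpow_of_add_rpow_le (d := fun j ↦ ‖x j - xstar‖) hμ hα hp hD hDμ
    (fun _ ↦ norm_nonneg _) (le_max_right _ _) hrec hk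
  have hDsq : D ^ 2 ≤ max ((a ^ p) ^ 2) (‖x 0 - xstar‖ ^ 2) := by
    rcases max_choice (a ^ p) ‖x 0 - xstar‖ with h | h <;> simp [hD_def, h]
  calc ‖x k - xstar‖ ^ 2 ≤ (D / (k : ℝ) ^ p) ^ 2 := by gcongr
    _ = D ^ 2 / ((k : ℝ) ^ p) ^ 2 := div_pow _ _ _
    _ ≤ _ := by gcongr
end
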